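/- Let k ≥ 2. For the Closed Geodetic Game on the even cycle C_{2k}, for every vertex u one has 𝒢(C_{2k}, {u}) = k. -/

import Mathlib

open SimpleGraph

/-- mex: least nonnegative integer not in the set. -/
noncomputable def mex (X : Set ℕ) : ℕ := sInf Xᶜ

/-- The interval `I(u,v)`: vertices on some shortest `u`–`v` path. -/
def geodInterval {V : Type*} (G : SimpleGraph V) (u v : V) : Set V :=
  {w | G.dist u w + G.dist w v = G.dist u v}

/-- The geodetic closure `(S)`. -/
def geodClosure {V : Type*} (G : SimpleGraph V) (S : Set V) : Set V :=
  ⋃ u ∈ S, ⋃ v ∈ S, geodInterval G u v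

/-- Sprague–Grundy value of the Closed Geodetic Game on `G` with selected set `S`. -/
noncomputable def grundy {V : Type*} [Fintype V] [DecidableEq V]
    (G : SimpleGraph V) (S : Finset V) : ℕ :=
  mex (Set.range fun v : {v : V // v ∉ geodClosure G ↑S} =>
    grundy G (insert v.1 S))
termination_by Sᶜ.card
decreasing_by
  have hv : (v : V) ∉ S := by
    intro h
    exact v.2 (Set.mem_biUnion (by simpa using h)
      (Set.mem_biUnion (by simpa using h) (by simp [geodInterval])))
  simp only [Finset.compl_insert]
  exact Finset.card_erase_lt_of_mem (by simpa using hv)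

theorem mex_eq_of_notMem {X : Set ℕ} {m : ℕ} (hm : m ∉ X) (hlt : ∀ i < m, i ∈ X) : mex X = m := by
  refine le_antisymm (Nat.sInf_le hm) (le_of_not_gt fun h => ?_)
  exact Nat.sInf_mem (s := Xᶜ) ⟨m, hm⟩ (hlt _ h)

theorem mem_geodClosure {V : Type*} {G : SimpleGraph V} {S : Set V} {w : V} :
    w ∈ geodClosure G S ↔ ∃ u ∈ S, ∃ v ∈ S, G.dist u w + G.dist w v = G.dist u v := by
  simp [geodClosure, geodInterval]

theorem grundy_eq_zero_of_geodClosure_eq_univ {V : Type*} [Fintype V] [DecidableEq V]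
    {G : SimpleGraph V} {S : Finset V} (h : ∀ w, w ∈ geodClosure G (S : Set V)) :
    grundy G S = 0 := by
  rw [grundy]
  refine mex_eq_of_notMem ?_ (by simp)
  rintro ⟨⟨v, hv⟩, -⟩
  exact hv (h v)

theorem cycleGraph_adj_iff_val {n : ℕ} (hn : 2 ≤ n) {u v : Fin n} :
    (cycleGraph n).Adj u v ↔ u.val + 1 = v.val ∨ v.val + 1 = u.val ∨
      (u.val = 0 ∧ v.val + 1 = n) ∨ (v.val = 0 ∧ u.val + 1 = n) := by
  rw [cycleGraph_adj']
  have hu := u.isLt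
  have hv := v.isLt
  rcases lt_trichotomy u v with h | h | h
  · rw [Fin.coe_sub_iff_lt.2 h, Fin.coe_sub_iff_le.2 h.le]
    have : u.val < v.val := h
    omega
  · subst h
    rw [Fin.coe_sub_iff_le.2 le_rfl]
    omega
  · rw [Fin.coe_sub_iff_lt.2 h, Fin.coe_sub_iff_le.2 h.le]
    have : v.val < u.val := h
    omega

theorem cycleGraph_dist_le_sub {n : ℕ} (u v : Fin n) (h : u ≤ v) :
    (cycleGraph n).dist u v ≤ v.val - u.val := by
  have key : ∀ (d : ℕ) (w : Fin n), w.val = u.val + d → (cycleGraph n).dist u w ≤ d := by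
    intro d
    induction d with
    | zero =>
      intro w hw
      rw [show w = u from Fin.ext hw, dist_self]
    | succ d ih =>
      intro w hw
      have hlt := w.isLt
      let x : Fin n := ⟨u.val + d, by omega⟩
      have hx := ih x rfl
      have hadj : (cycleGraph n).Adj x w :=
        (cycleGraph_adj_iff_val (by omega)).2 (.inl (by simp only [x]; omega))
      have htri := (cycleGraph_preconnected u x).dist_triangle_left w
      rw [dist_eq_one_iff_adj.2 hadj] at htri
      omega
  have : u.val ≤ v.val := h
  exact key _ v (by omega)

theorem cycleGraph_dist_le_sub_sub {n : ℕ} (hn : 2 ≤ n) (u v : Fin n) (h : u ≤ v) :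
    (cycleGraph n).dist u v ≤ n - (v.val - u.val) := by
  have : u.val ≤ v.val := h
  have hv := v.isLt
  let a : Fin n := ⟨0, by omega⟩
  let b : Fin n := ⟨n - 1, by omega⟩
  have hua := cycleGraph_dist_le_sub a u (Fin.le_def.2 (Nat.zero_le _))
  have hvb := cycleGraph_dist_le_sub v b (Fin.le_def.2 (by simp only [b]; omega))
  have hab : (cycleGraph n).Adj a b :=
    (cycleGraph_adj_iff_val hn).2 (.inr (.inr (.inl ⟨rfl, by simp only [b]; omega⟩)))
  have h₁ := (cycleGraph_preconnected u a).dist_triangle_left v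
  have h₂ := (cycleGraph_preconnected a b).dist_triangle_left v
  rw [dist_eq_one_iff_adj.2 hab] at h₂
  rw [dist_comm] at hua hvb
  simp only [a, b] at *
  omega

theorem cycleGraph_min_le_length {n : ℕ} (hn : 2 ≤ n) {u v : Fin n} (p : (cycleGraph n).Walk u v) :
    min ((v.val - u.val) + (u.val - v.val)) (n - ((v.val - u.val) + (u.val - v.val))) ≤
      p.length := by
  induction p with
  | nil => simp
  | @cons u x v hadj p ih =>
    rw [cycleGraph_adj_iff_val hn] at hadj
    rw [Walk.length_cons]
    have := u.isLt
    have := v.isLt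
    omega

theorem cycleGraph_dist_eq {n : ℕ} (hn : 2 ≤ n) (u v : Fin n) :
    (cycleGraph n).dist u v =
      min ((v.val - u.val) + (u.val - v.val)) (n - ((v.val - u.val) + (u.val - v.val))) := by
  apply le_antisymm
  · rcases le_total u v with h | h
    · have h₁ := cycleGraph_dist_le_sub u v h
      have h₂ := cycleGraph_dist_le_sub_sub hn u v h
      have : u.val ≤ v.val := h
      omega
    · have h₁ := cycleGraph_dist_le_sub v u h
      have h₂ := cycleGraph_dist_le_sub_sub hn v u h
      rw [dist_comm] at h₁ h₂
      have : v.val ≤ u.val := h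
      omega
  · obtain ⟨p, hp⟩ := (cycleGraph_preconnected u v).exists_walk_length_eq_dist
    rw [← hp]
    exact cycleGraph_min_le_length hn p

theorem cycleGraph_dist_spec {k : ℕ} (hk : 1 ≤ k) (u v : Fin (2 * k)) :
    (cycleGraph (2 * k)).dist u v ≤ k ∧
      ((cycleGraph (2 * k)).dist u v + u.val = v.val ∨
        (cycleGraph (2 * k)).dist u v + v.val = u.val ∨
        (cycleGraph (2 * k)).dist u v + u.val = v.val + 2 * k ∨
        (cycleGraph (2 * k)).dist u v + v.val = u.val + 2 * k) := by
  rw [cycleGraph_dist_eq (by omega)]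
  have := u.isLt
  have := v.isLt
  omega

/-- `x` lies on the arc `a, a + 1, …, a + m` of the cycle on `n` vertices. -/
def OnArc (n a m x : ℕ) : Prop := (a ≤ x ∧ x ≤ a + m) ∨ x + n ≤ a + m

/-- `S` is contained in the arc `a, a + 1, …, a + m` and contains both of its ends. -/
structure SpansArc {n : ℕ} (S : Finset (Fin n)) (a m : ℕ) : Prop where
  onArc : ∀ s ∈ S, OnArc n a m s.val
  left_mem : ∃ s ∈ S, s.val = a
  right_mem : ∃ s ∈ S, s.val = a + m ∨ s.val + n = a + m

theorem SpansArc.mem_geodClosure_iff {k : ℕ} (hk : 2 ≤ k) {S : Finset (Fin (2 * k))} {a m : ℕ}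
    (h : SpansArc S a m) (hm : m < k) (w : Fin (2 * k)) :
    w ∈ geodClosure (cycleGraph (2 * k)) (S : Set (Fin (2 * k))) ↔ OnArc (2 * k) a m w.val := by
  have hw := w.isLt
  simp only [mem_geodClosure, Finset.mem_coe, OnArc]
  have hk' : 1 ≤ k := by omega
  obtain ⟨s, hs, hsa⟩ := h.left_mem
  have := s.isLt
  constructor
  · rintro ⟨u, hu, v, hv, huv⟩
    have hu' := h.onArc u hu
    have hv' := h.onArc v hv
    have := u.isLt
    have := v.isLt
    unfold OnArc at hu' hv'
    obtain ⟨h₁, h₁'⟩ := cycleGraph_dist_spec hk' u w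
    obtain ⟨h₂, h₂'⟩ := cycleGraph_dist_spec hk' w v
    obtain ⟨h₃, h₃'⟩ := cycleGraph_dist_spec hk' u v
    omega
  · intro hwa
    obtain ⟨t, ht, hta⟩ := h.right_mem
    have := t.isLt
    refine ⟨s, hs, t, ht, ?_⟩
    obtain ⟨h₁, h₁'⟩ := cycleGraph_dist_spec hk' s w
    obtain ⟨h₂, h₂'⟩ := cycleGraph_dist_spec hk' w t
    obtain ⟨h₃, h₃'⟩ := cycleGraph_dist_spec hk' s t
    omega

/-- Selecting a vertex antipodal to some vertex of the spanned arc ends the game. -/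
theorem SpansArc.grundy_insert_eq_zero {k : ℕ} (hk : 2 ≤ k) {S : Finset (Fin (2 * k))} {a m : ℕ}
    (h : SpansArc S a m) (hm : m < k) (v : Fin (2 * k))
    (hv : (a + k ≤ v.val ∧ v.val ≤ a + k + m) ∨
      (a + k ≤ v.val + 2 * k ∧ v.val + 2 * k ≤ a + k + m)) :
    grundy (cycleGraph (2 * k)) (insert v S) = 0 := by
  apply grundy_eq_zero_of_geodClosure_eq_univ
  intro w
  obtain ⟨s, hs, hsa⟩ := h.left_mem
  obtain ⟨t, ht, hta⟩ := h.right_mem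
  have := s.isLt
  have := t.isLt
  have := v.isLt
  have := w.isLt
  simp only [mem_geodClosure, Finset.mem_coe]
  have hk' : 1 ≤ k := by omega
  have hsS := Finset.mem_insert_of_mem (b := v) hs
  have htS := Finset.mem_insert_of_mem (b := v) ht
  have hvS := Finset.mem_insert_self v S
  by_cases h₁ : OnArc (2 * k) a m w.val
  · refine ⟨s, hsS, t, htS, ?_⟩
    unfold OnArc at h₁
    obtain ⟨hsw, hsw'⟩ := cycleGraph_dist_spec hk' s w
    obtain ⟨hwt, hwt'⟩ := cycleGraph_dist_spec hk' w t
    obtain ⟨hst, hst'⟩ := cycleGraph_dist_spec hk' s t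
    omega
  unfold OnArc at h₁
  by_cases h₂ : (t.val ≤ w.val ∧ w.val ≤ v.val) ∨ (v.val < t.val ∧ (t.val ≤ w.val ∨ w.val ≤ v.val))
  · refine ⟨t, htS, v, hvS, ?_⟩
    obtain ⟨htw, htw'⟩ := cycleGraph_dist_spec hk' t w
    obtain ⟨hwv, hwv'⟩ := cycleGraph_dist_spec hk' w v
    obtain ⟨htv, htv'⟩ := cycleGraph_dist_spec hk' t v
    omega
  · refine ⟨v, hvS, s, hsS, ?_⟩
    obtain ⟨hvw, hvw'⟩ := cycleGraph_dist_spec hk' v w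
    obtain ⟨hws, hws'⟩ := cycleGraph_dist_spec hk' w s
    obtain ⟨hvs, hvs'⟩ := cycleGraph_dist_spec hk' v s
    omega

theorem SpansArc.insert_right {n : ℕ} {S : Finset (Fin n)} {a m m' : ℕ} (h : SpansArc S a m)
    (hmm' : m ≤ m') {v : Fin n} (hv : v.val = a + m' ∨ v.val + n = a + m') :
    SpansArc (insert v S) a m' := by
  refine ⟨fun s hs => ?_, ?_, v, Finset.mem_insert_self v S, hv⟩
  · rcases Finset.mem_insert.1 hs with rfl | hs
    · unfold OnArc
      omega
    · have := h.onArc s hs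
      unfold OnArc at *
      omega
  · obtain ⟨s, hs, hsa⟩ := h.left_mem
    exact ⟨s, Finset.mem_insert_of_mem hs, hsa⟩

theorem SpansArc.insert_left {n : ℕ} {S : Finset (Fin n)} {a m m' : ℕ} (h : SpansArc S a m)
    (hm' : m' < n) {v : Fin n} (hmm' : m ≤ m')
    (hv : v.val + m' = a + m ∨ v.val + m' = a + m + n) :
    SpansArc (insert v S) v.val m' := by
  have hvn := v.isLt
  refine ⟨fun s hs => ?_, ⟨v, Finset.mem_insert_self v S, rfl⟩, ?_⟩
  · rcases Finset.mem_insert.1 hs with rfl | hs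
    · unfold OnArc
      omega
    · have := h.onArc s hs
      have := s.isLt
      unfold OnArc at *
      omega
  · obtain ⟨s, hs, hsa⟩ := h.right_mem
    have := s.isLt
    exact ⟨s, Finset.mem_insert_of_mem hs, by omega⟩

theorem SpansArc.grundy_eq {k : ℕ} (hk : 2 ≤ k) {S : Finset (Fin (2 * k))} {a m : ℕ}
    (h : SpansArc S a m) (hm : m < k) : grundy (cycleGraph (2 * k)) S = k - m := by
  induction hd : k - m using Nat.strong_induction_on generalizing S a m with
  | _ d ih =>
  obtain ⟨s₀, -, hs₀⟩ := h.left_mem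
  have ha := s₀.isLt
  rw [hs₀] at ha
  rw [grundy]
  apply mex_eq_of_notMem
  · rintro ⟨⟨v, hv⟩, hvd⟩
    rw [h.mem_geodClosure_iff hk hm] at hv
    have hvn := v.isLt
    simp only at hvd
    obtain ⟨off, hoff, hvo⟩ : ∃ off < 2 * k, v.val = a + off ∨ v.val + 2 * k = a + off := by
      rcases le_or_gt a v.val with h₁ | h₁
      · exact ⟨v.val - a, by omega, by omega⟩
      · exact ⟨v.val + 2 * k - a, by omega, by omega⟩
    unfold OnArc at hv
    rcases lt_or_ge off k with h₁ | h₁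
    · have := ih (k - off) (by omega) (h.insert_right (m' := off) (by omega) hvo) h₁ rfl
      omega
    rcases lt_or_ge (k + m) off with h₂ | h₂
    · have := ih (k - (2 * k - off + m)) (by omega)
        (h.insert_left (v := v) (m' := 2 * k - off + m) (by omega) (by omega) (by omega))
        (by omega) rfl
      omega
    · have := h.grundy_insert_eq_zero hk hm v (by omega)
      omega
  · intro i hi
    obtain ⟨v, hv⟩ : ∃ v : Fin (2 * k), v.val = a + (k - i) ∨ v.val + 2 * k = a + (k - i) := by
      rcases lt_or_ge (a + (k - i)) (2 * k) with h₁ | h₁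
      · exact ⟨⟨_, h₁⟩, .inl rfl⟩
      · exact ⟨⟨a + (k - i) - 2 * k, by omega⟩, .inr (by simp only; omega)⟩
    have hvn := v.isLt
    refine ⟨⟨v, ?_⟩, ?_⟩
    · rw [h.mem_geodClosure_iff hk hm]
      unfold OnArc
      omega
    · simp only
      rcases Nat.eq_zero_or_pos i with rfl | hpos
      · exact h.grundy_insert_eq_zero hk hm v (by omega)
      · exact ih i hi (h.insert_right (m' := k - i) (by omega) hv) (by omega) (by omega)

/-- on the even cycle `C_{2k}` (`k ≥ 2`), the Grundy value of the Closed
Geodetic Game position with one vertex `u` selected is `k`. -/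
theorem grundy_even_cycle_one_vertex (k : ℕ) (hk : 2 ≤ k) (u : Fin (2 * k)) :
    grundy (SimpleGraph.cycleGraph (2 * k)) ({u} : Finset (Fin (2 * k))) = k := by
  have h : SpansArc {u} u.val 0 := by
    refine ⟨fun s hs => ?_, ⟨u, by simp⟩, ⟨u, by simp⟩⟩
    rw [Finset.mem_singleton.1 hs]
    exact .inl ⟨le_rfl, le_rfl⟩
  exact h.grundy_eq hk (by omega)
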